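/- arXiv:2602.04644 — 3 statements merged into one kernel-verified Lean document; each statement's English description precedes it below -/
import Mathlib

section
/- Let n ∈ ℕ, De > 0, let L ∈ Matrix n n ℝ be a diagonal matrix with strictly positive diagonal entries, and let M ∈ Matrix n n ℝ be symmetric positive definite with L * M = M * L. Define ψ : (Fin n → ℝ) → ℝ by ψ(q) = exp(−De · qᵀ L⁻¹ M q). Then for every q ∈ ℝⁿ the steady-state Fokker–Planck flux vanishes: (M q) · ψ(q) + (1/(2·De)) · L • (gradient of ψ at q) = 0, where the gradient of ψ at q is the vector of partial derivatives of ψ. -/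
open Matrix Real

/-- The quadratic form `qᵀ B q = ∑ᵢⱼ qᵢ Bᵢⱼ qⱼ` of a matrix `B`. -/
noncomputable def quadForm {n : ℕ} (B : Matrix (Fin n) (Fin n) ℝ) (q : Fin n → ℝ) : ℝ :=
  ∑ i, ∑ j, q i * B i j * q j

/-- The gradient of a scalar function on `ℝⁿ`: the vector of partial derivatives. -/
noncomputable def grad {n : ℕ} (f : (Fin n → ℝ) → ℝ) (q : Fin n → ℝ) : Fin n → ℝ :=
  fun i => fderiv ℝ f q (Pi.single i 1)

theorem quadForm_hasFDerivAt {n : ℕ} (B : Matrix (Fin n) (Fin n) ℝ) (q : Fin n → ℝ) :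
    HasFDerivAt (quadForm B)
      (∑ i, ∑ j, ((q i * B i j) • (ContinuousLinearMap.proj (R := ℝ) (φ := fun _ : Fin n => ℝ) j)
        + (q j) • (B i j) • (ContinuousLinearMap.proj (R := ℝ) (φ := fun _ : Fin n => ℝ) i))) q := by
  unfold quadForm
  refine HasFDerivAt.fun_sum fun i _ => HasFDerivAt.fun_sum fun j _ => ?_
  exact ((hasFDerivAt_apply i q).mul_const (B i j)).mul (hasFDerivAt_apply j q)

theorem grad_exp_quadForm {n : ℕ} (De : ℝ) (B : Matrix (Fin n) (Fin n) ℝ) (hB : Bᵀ = B)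
    (q : Fin n → ℝ) :
    grad (fun p => Real.exp (-De * quadForm B p)) q
      = (-(2 * De) * Real.exp (-De * quadForm B q)) • B.mulVec q := by
  funext k
  have h := ((quadForm_hasFDerivAt B q).const_mul (-De)).exp
  have hs : ∀ i j, B i j = B j i := fun i j => congrFun (congrFun hB j) i
  unfold grad
  rw [h.fderiv]
  have e : ∑ i, q i * B i k = ∑ i, q i * B k i :=
    Finset.sum_congr rfl fun i _ => by rw [hs i k]
  simp [Pi.single_apply, Finset.sum_add_distrib, Matrix.mulVec, dotProduct, mul_comm (B k _), e]
  ring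

/-- For the Gaussian `ψ(q) = exp(−De · qᵀ L⁻¹ M q)`, with `L` diagonal positive, `M` symmetric
positive definite and `L M = M L`, the steady-state Fokker–Planck flux vanishes:
`(M q) ψ(q) + (1/(2 De)) L ∇ψ(q) = 0`. -/
theorem steady_state_flux_vanishes {n : ℕ} (De : ℝ) (hDe : 0 < De)
    (L M : Matrix (Fin n) (Fin n) ℝ)
    (hLdiag : L.IsDiag) (hLpos : ∀ i, 0 < L i i)
    (hM : M.PosDef) (hcomm : L * M = M * L) :
    ∀ q : Fin n → ℝ,
      M.mulVec q * (fun _ => Real.exp (-De * quadForm (L⁻¹ * M) q))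
        + (1 / (2 * De)) •
          L.mulVec (grad (fun p => Real.exp (-De * quadForm (L⁻¹ * M) p)) q) = 0 := by
  intro q
  have hdet : IsUnit L.det := by
    rw [← hLdiag.diagonal_diag, Matrix.det_diagonal]
    exact (Finset.prod_pos fun i _ => hLpos i).ne'.isUnit
  have hLt : Lᵀ = L := hLdiag.isSymm
  have hMt : Mᵀ = M := by simpa using hM.isHermitian.eq
  have hc : M * L⁻¹ = L⁻¹ * M := by
    calc M * L⁻¹ = L⁻¹ * (L * M) * L⁻¹ := by rw [Matrix.nonsing_inv_mul_cancel_left _ _ hdet]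
      _ = L⁻¹ * M := by
        rw [hcomm, ← Matrix.mul_assoc, Matrix.mul_nonsing_inv_cancel_right _ _ hdet]
  have hB : (L⁻¹ * M)ᵀ = L⁻¹ * M := by
    rw [Matrix.transpose_mul, Matrix.transpose_nonsing_inv, hLt, hMt, hc]
  rw [grad_exp_quadForm De _ hB, Matrix.mulVec_smul, Matrix.mulVec_mulVec,
    Matrix.mul_nonsing_inv_cancel_left _ _ hdet]
  funext k
  simp only [Pi.add_apply, Pi.mul_apply, Pi.smul_apply, smul_eq_mul, Pi.zero_apply]
  field_simp
  ring
end

section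
/- Let n ∈ ℕ, let C : ℝ → Matrix n n ℝ be such that C(s₀) is symmetric positive definite and C has derivative C' at s₀ (in the sense HasDerivAt). Fix q ∈ ℝⁿ. Then the function s ↦ Φ(C(s), q) has derivative at s₀ equal to (1/2) · (qᵀ C(s₀)⁻¹ C' C(s₀)⁻¹ q − trace(C(s₀)⁻¹ C')) · Φ(C(s₀), q). -/
open Matrix Real

attribute [local instance] Matrix.normedAddCommGroup Matrix.normedSpace

/-- The centered Gaussian probability density with covariance matrix `C`,
`Φ(C, q) = exp(−(1/2) qᵀ C⁻¹ q) / √((2π)ⁿ det C)`. -/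
noncomputable def gaussPdf {n : ℕ} (C : Matrix (Fin n) (Fin n) ℝ) (q : Fin n → ℝ) : ℝ :=
  Real.exp (-(1 / 2) * quadForm C⁻¹ q) / Real.sqrt ((2 * Real.pi) ^ n * C.det)

/-- Jacobi's formula, entrywise. -/
theorem hasDerivAt_det_aux {n : ℕ} (C : ℝ → Matrix (Fin n) (Fin n) ℝ)
    (C' : Matrix (Fin n) (Fin n) ℝ) (s₀ : ℝ)
    (hC : ∀ i j, HasDerivAt (fun s => C s i j) (C' i j) s₀) :
    HasDerivAt (fun s => (C s).det) ((C s₀).adjugate * C').trace s₀ := by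
  have h1 : HasDerivAt (fun s => (C s).det)
      (∑ σ : Equiv.Perm (Fin n), ((Equiv.Perm.sign σ : ℤ) : ℝ) *
        ∑ i, (∏ j ∈ Finset.univ.erase i, C s₀ (σ j) j) • C' (σ i) i) s₀ := by
    simp only [Matrix.det_apply']
    refine HasDerivAt.fun_sum fun σ _ => HasDerivAt.const_mul _ ?_
    exact HasDerivAt.fun_finsetProd fun i _ => hC (σ i) i
  convert h1 using 1
  have h2 : ∀ i, ((C s₀).adjugate * C') i i
      = ((C s₀).updateCol i (fun k => C' k i)).det := by
    intro i
    rw [← Matrix.cramer_apply, Matrix.cramer_eq_adjugate_mulVec]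
    rfl
  simp only [Matrix.trace, Matrix.diag_apply, h2, Matrix.det_apply', Finset.mul_sum]
  rw [Finset.sum_comm]
  refine Finset.sum_congr rfl fun σ _ => Finset.sum_congr rfl fun i _ => ?_
  congr 1
  rw [← Finset.prod_erase_mul _ _ (Finset.mem_univ i)]
  simp only [Matrix.updateCol_self, smul_eq_mul]
  congr 1
  refine Finset.prod_congr rfl fun j hj => ?_
  rw [Matrix.updateCol_ne (Finset.ne_of_mem_erase hj)]

theorem hasDerivAt_inv_aux {n : ℕ} (C : ℝ → Matrix (Fin n) (Fin n) ℝ)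
    (C' : Matrix (Fin n) (Fin n) ℝ) (s₀ : ℝ) (hdet : (C s₀).det ≠ 0)
    (hC : ∀ i j, HasDerivAt (fun s => C s i j) (C' i j) s₀) (i j : Fin n) :
    HasDerivAt (fun s => (C s)⁻¹ i j) ((-((C s₀)⁻¹ * C' * (C s₀)⁻¹)) i j) s₀ := by
  have hd := hasDerivAt_det_aux C C' s₀ hC
  have hdiff : ∀ i j, DifferentiableAt ℝ (fun s => (C s)⁻¹ i j) s₀ := by
    intro i j
    simp only [Matrix.inv_def, Matrix.smul_apply, Ring.inverse_eq_inv', smul_eq_mul,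
      Matrix.adjugate_apply]
    refine (hd.differentiableAt.inv hdet).mul ?_
    refine (hasDerivAt_det_aux (fun s => (C s).updateRow j (Pi.single i 1))
      (C'.updateRow j 0) s₀ ?_).differentiableAt
    intro k l
    by_cases hk : k = j
    · subst hk
      simpa using hasDerivAt_const s₀ _
    · simpa [Matrix.updateRow_ne hk] using hC k l
  let D : Matrix (Fin n) (Fin n) ℝ := Matrix.of fun i j => deriv (fun s => (C s)⁻¹ i j) s₀
  have hD : ∀ i j, HasDerivAt (fun s => (C s)⁻¹ i j) (D i j) s₀ :=
    fun i j => (hdiff i j).hasDerivAt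
  have hne : ∀ᶠ s in nhds s₀, (C s).det ≠ 0 := hd.continuousAt.eventually_ne hdet
  have hz : C' * (C s₀)⁻¹ + C s₀ * D = 0 := by
    ext k l
    have h1 : HasDerivAt (fun s => (C s * (C s)⁻¹) k l)
        ((C' * (C s₀)⁻¹ + C s₀ * D) k l) s₀ := by
      simp only [Matrix.mul_apply, Matrix.add_apply, ← Finset.sum_add_distrib]
      exact HasDerivAt.fun_sum fun m _ => (hC k m).mul (hD m l)
    have h2 : HasDerivAt (fun s => (C s * (C s)⁻¹) k l) 0 s₀ := by
      refine (hasDerivAt_const s₀ ((1 : Matrix (Fin n) (Fin n) ℝ) k l)).congr_of_eventuallyEq ?_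
      filter_upwards [hne] with s hs
      rw [Matrix.mul_nonsing_inv _ (isUnit_iff_ne_zero.mpr hs)]
    exact h1.unique h2
  have hDe : D = -((C s₀)⁻¹ * C' * (C s₀)⁻¹) := by
    have h3 : C s₀ * D = -(C' * (C s₀)⁻¹) := eq_neg_of_add_eq_zero_right hz
    have h4 := congrArg (fun M => (C s₀)⁻¹ * M) h3
    simp only [← Matrix.mul_assoc, Matrix.nonsing_inv_mul _ (isUnit_iff_ne_zero.mpr hdet),
      Matrix.one_mul, Matrix.mul_neg] at h4
    exact h4
  rw [← hDe]
  exact hD i j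

/-- Derivative of `s ↦ Φ(C(s), q)` along a curve of covariance matrices passing through a
symmetric positive definite matrix: it equals
`(1/2)(qᵀ C⁻¹ C' C⁻¹ q − tr(C⁻¹ C')) Φ(C, q)`. -/
theorem hasDerivAt_gaussPdf_comp {n : ℕ} (C : ℝ → Matrix (Fin n) (Fin n) ℝ)
    (C' : Matrix (Fin n) (Fin n) ℝ) (s₀ : ℝ)
    (hpos : (C s₀).PosDef) (hC : HasDerivAt C C' s₀) (q : Fin n → ℝ) :
    HasDerivAt (fun s => gaussPdf (C s) q)
      ((1 / 2) * (quadForm ((C s₀)⁻¹ * C' * (C s₀)⁻¹) q - ((C s₀)⁻¹ * C').trace)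
        * gaussPdf (C s₀) q) s₀ := by
  have hent : ∀ i j, HasDerivAt (fun s => C s i j) (C' i j) s₀ := fun i j =>
    hasDerivAt_pi.1 (hasDerivAt_pi.1 hC i) j
  have hdpos : 0 < (C s₀).det := hpos.det_pos
  have hd := hasDerivAt_det_aux C C' s₀ hent
  have hq : HasDerivAt (fun s => quadForm (C s)⁻¹ q)
      (-quadForm ((C s₀)⁻¹ * C' * (C s₀)⁻¹) q) s₀ := by
    have h : HasDerivAt (fun s => quadForm (C s)⁻¹ q)
      (quadForm (-((C s₀)⁻¹ * C' * (C s₀)⁻¹)) q) s₀ := by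
      unfold quadForm
      exact HasDerivAt.fun_sum fun i _ => HasDerivAt.fun_sum fun j _ =>
        ((hasDerivAt_inv_aux C C' s₀ hdpos.ne' hent i j).const_mul _).mul_const _
    convert h using 1
    simp [quadForm]
  have htr : ((C s₀).adjugate * C').trace = (C s₀).det * ((C s₀)⁻¹ * C').trace := by
    rw [Matrix.inv_def, Ring.inverse_eq_inv', Matrix.smul_mul, Matrix.trace_smul, smul_eq_mul,
      mul_inv_cancel_left₀ hdpos.ne']
  rw [htr] at hd
  have hpp : 0 < (2 * Real.pi) ^ n * (C s₀).det := by positivity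
  have hs := (hd.const_mul ((2 * Real.pi) ^ n)).sqrt hpp.ne'
  have hmain := ((hq.const_mul (-(1 / 2))).exp).div hs (Real.sqrt_pos.2 hpp).ne'
  unfold gaussPdf
  refine hmain.congr_deriv ?_
  have hr : 0 < √((2 * Real.pi) ^ n * (C s₀).det) := Real.sqrt_pos.2 hpp
  have hsq : √((2 * Real.pi) ^ n * (C s₀).det) ^ 2 = (2 * Real.pi) ^ n * (C s₀).det :=
    Real.sq_sqrt hpp.le
  rw [← mul_assoc ((2 * Real.pi) ^ n), ← hsq]
  rw [Real.sqrt_sq hr.le]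
  generalize √((2 * Real.pi) ^ n * (C s₀).det) = r at *
  field_simp
end

section
/- Let n, d ∈ ℕ and let C : (Fin d → ℝ) → Matrix n n ℝ take symmetric positive definite values and be twice differentiable at x₀. Fix q ∈ ℝⁿ and write Dᵢ = ∂C/∂xᵢ (x₀) and Eᵢ = ∂²C/∂xᵢ² (x₀), and abbreviate C = C(x₀). Then the Laplacian in x of the function x ↦ Φ(C(x), q) at x₀ equals [ (1/2)·(qᵀ C⁻¹ (∑ᵢ Eᵢ) C⁻¹ q − trace(C⁻¹ ∑ᵢ Eᵢ)) − ∑ᵢ ( qᵀ (C⁻¹ Dᵢ)² C⁻¹ q − (1/2)·trace((C⁻¹ Dᵢ)²) ) + (1/4)·∑ᵢ ( qᵀ C⁻¹ Dᵢ C⁻¹ q − trace(C⁻¹ Dᵢ) )² ] · Φ(C, q). -/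
open Matrix Real

/-- The first partial derivative `∂C/∂xᵢ(x₀)` of a matrix-valued function, entrywise. -/
noncomputable def matPartial {n d : ℕ} (C : (Fin d → ℝ) → Matrix (Fin n) (Fin n) ℝ)
    (x₀ : Fin d → ℝ) (i : Fin d) : Matrix (Fin n) (Fin n) ℝ :=
  Matrix.of fun k l => fderiv ℝ (fun x => C x k l) x₀ (Pi.single i 1)

/-- The second partial derivative `∂²C/∂xᵢ²(x₀)` of a matrix-valued function, entrywise. -/
noncomputable def matPartial2 {n d : ℕ} (C : (Fin d → ℝ) → Matrix (Fin n) (Fin n) ℝ)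
    (x₀ : Fin d → ℝ) (i : Fin d) : Matrix (Fin n) (Fin n) ℝ :=
  Matrix.of fun k l =>
    fderiv ℝ (fun x => fderiv ℝ (fun y => C y k l) x (Pi.single i 1)) x₀ (Pi.single i 1)

/-- `f` is differentiable at `x`, with directional derivative `f'` along `v`. -/
def DirD {E : Type*} [NormedAddCommGroup E] [NormedSpace ℝ E] (v x : E) (f : E → ℝ) (f' : ℝ) :
    Prop := ∃ L : E →L[ℝ] ℝ, HasFDerivAt f L x ∧ L v = f'

/-- Entrywise version of `DirD`. -/
def MatD {E : Type*} [NormedAddCommGroup E] [NormedSpace ℝ E] {n : ℕ} (v x : E)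
    (M : E → Matrix (Fin n) (Fin n) ℝ) (M' : Matrix (Fin n) (Fin n) ℝ) : Prop :=
  ∀ k l, DirD v x (fun y => M y k l) (M' k l)

section helpers
variable {E : Type*} [NormedAddCommGroup E] [NormedSpace ℝ E] {n : ℕ} {v x : E}

theorem DirD.fderiv_eq {f : E → ℝ} {f' : ℝ} (h : DirD v x f f') : fderiv ℝ f x v = f' := by
  obtain ⟨L, hL, h⟩ := h
  rw [hL.fderiv, h]

theorem DirD.of_diff {f : E → ℝ} (h : DifferentiableAt ℝ f x) : DirD v x f (fderiv ℝ f x v) :=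
  ⟨_, h.hasFDerivAt, rfl⟩

theorem DirD.diff {f : E → ℝ} {f' : ℝ} (h : DirD v x f f') : DifferentiableAt ℝ f x := by
  obtain ⟨L, hL, h⟩ := h
  exact hL.differentiableAt

theorem DirD.const (c : ℝ) : DirD v x (fun _ => c) 0 :=
  ⟨0, hasFDerivAt_const c x, rfl⟩

theorem DirD.sub {f g : E → ℝ} {f' g' : ℝ} (hf : DirD v x f f') (hg : DirD v x g g') :
    DirD v x (fun y => f y - g y) (f' - g') := by
  obtain ⟨L, hL, rfl⟩ := hf
  obtain ⟨K, hK, rfl⟩ := hg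
  exact ⟨L - K, hL.sub hK, rfl⟩

theorem DirD.mul {f g : E → ℝ} {f' g' : ℝ} (hf : DirD v x f f') (hg : DirD v x g g') :
    DirD v x (fun y => f y * g y) (f' * g x + f x * g') := by
  obtain ⟨L, hL, rfl⟩ := hf
  obtain ⟨K, hK, rfl⟩ := hg
  refine ⟨_, hL.mul hK, ?_⟩
  simp
  ring

theorem DirD.comp {f : E → ℝ} {f' : ℝ} {g : ℝ → ℝ} {g' : ℝ} (hf : DirD v x f f')
    (hg : HasDerivAt g g' (f x)) : DirD v x (fun y => g (f y)) (g' * f') := by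
  obtain ⟨L, hL, rfl⟩ := hf
  exact ⟨_, hg.comp_hasFDerivAt x hL, by simp⟩

theorem DirD.sum {ι : Type*} {s : Finset ι} {f : ι → E → ℝ} {f' : ι → ℝ}
    (h : ∀ i ∈ s, DirD v x (f i) (f' i)) :
    DirD v x (fun y => ∑ i ∈ s, f i y) (∑ i ∈ s, f' i) := by
  classical
  choose! L hL h' using h
  refine ⟨∑ i ∈ s, L i, HasFDerivAt.fun_sum hL, ?_⟩
  rw [_root_.sum_apply]
  exact Finset.sum_congr rfl h'

theorem MatD.mul {M N : E → Matrix (Fin n) (Fin n) ℝ} {M' N' : Matrix (Fin n) (Fin n) ℝ}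
    (hM : MatD v x M M') (hN : MatD v x N N') :
    MatD v x (fun y => M y * N y) (M' * N x + M x * N') := by
  intro k l
  simp only [Matrix.mul_apply, Matrix.add_apply, ← Finset.sum_add_distrib]
  exact DirD.sum fun i _ => (hM k i).mul (hN i l)

theorem MatD.trace {M : E → Matrix (Fin n) (Fin n) ℝ} {M' : Matrix (Fin n) (Fin n) ℝ}
    (hM : MatD v x M M') : DirD v x (fun y => (M y).trace) M'.trace :=
  DirD.sum fun i _ => hM i i

theorem MatD.quad {M : E → Matrix (Fin n) (Fin n) ℝ} {M' : Matrix (Fin n) (Fin n) ℝ}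
    (hM : MatD v x M M') (q : Fin n → ℝ) :
    DirD v x (fun y => quadForm (M y) q) (quadForm M' q) := by
  refine DirD.sum fun i _ => DirD.sum fun j _ => ?_
  have := ((DirD.const (q i)).mul (hM i j)).mul (DirD.const (v := v) (x := x) (q j))
  simpa using this

theorem MatD.det {M : E → Matrix (Fin n) (Fin n) ℝ} {M' : Matrix (Fin n) (Fin n) ℝ}
    (hM : MatD v x M M') : DirD v x (fun y => (M y).det) ((M x).adjugate * M').trace := by
  choose L hL h' using hM
  let F : ContinuousMultilinearMap ℝ (fun _ : Fin n => (Fin n → ℝ)) ℝ :=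
    { (Matrix.detRowAlternating (R := ℝ) (n := Fin n)).toMultilinearMap with
      cont := (Continuous.matrix_det continuous_id :
        Continuous fun A : Matrix (Fin n) (Fin n) ℝ => A.det) }
  have hF : HasFDerivAt (fun y : E => fun k l => M y k l)
      (ContinuousLinearMap.pi fun k => ContinuousLinearMap.pi fun l => L k l) x := by
    rw [hasFDerivAt_pi]
    intro k
    rw [hasFDerivAt_pi]
    exact fun l => hL k l
  have hF2 : HasFDerivAt (F : (Fin n → Fin n → ℝ) → ℝ) (F.linearDeriv (fun k l => M x k l))
      (fun k l => M x k l) := F.hasFDerivAt _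
  have hF3 := HasFDerivAt.comp (f := fun y : E => fun k l => M y k l) x hF2 hF
  refine ⟨_, hF3, ?_⟩
  rw [ContinuousLinearMap.comp_apply, ContinuousMultilinearMap.linearDeriv_apply,
    Matrix.trace_mul_comm]
  simp only [Matrix.trace, Matrix.diag]
  refine Finset.sum_congr rfl fun i _ => ?_
  have h1 : (ContinuousLinearMap.pi fun k => ContinuousLinearMap.pi fun l => L k l) v = M' := by
    ext k l
    exact h' k l
  rw [h1]
  change ((M x).updateRow i (M' i)).det = _
  rw [← Matrix.cramer_transpose_apply, Matrix.cramer_eq_adjugate_mulVec,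
    ← Matrix.adjugate_transpose, Matrix.mul_apply]
  simp only [Matrix.mulVec, dotProduct, Matrix.transpose_apply]
  exact Finset.sum_congr rfl fun j _ => mul_comm _ _

theorem MatD.adj_diff {M : E → Matrix (Fin n) (Fin n) ℝ} {M' : Matrix (Fin n) (Fin n) ℝ}
    (hM : MatD v x M M') (k l : Fin n) : DifferentiableAt ℝ (fun y => (M y).adjugate k l) x := by
  simp only [Matrix.adjugate_apply]
  refine (MatD.det (v := v) (M := fun y => (M y).updateRow l (Pi.single k 1))
    (M' := M'.updateRow l 0) ?_).diff
  intro i j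
  by_cases h : i = l
  · subst h
    simpa using DirD.const _
  · simpa [Matrix.updateRow_ne h] using hM i j

theorem MatD.inv {M : E → Matrix (Fin n) (Fin n) ℝ} {M' : Matrix (Fin n) (Fin n) ℝ}
    (hM : MatD v x M M') (h0 : ∀ y, (M y).det ≠ 0) :
    MatD v x (fun y => (M y)⁻¹) (-((M x)⁻¹ * M' * (M x)⁻¹)) := by
  have hd : ∀ k l, DifferentiableAt ℝ (fun y => (M y)⁻¹ k l) x := by
    intro k l
    simp only [Matrix.inv_def, Matrix.smul_apply, Ring.inverse_eq_inv', smul_eq_mul]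
    exact (hM.det.diff.inv (h0 x)).mul (hM.adj_diff k l)
  let N : Matrix (Fin n) (Fin n) ℝ := Matrix.of fun k l => fderiv ℝ (fun y => (M y)⁻¹ k l) x v
  have hN : MatD v x (fun y => (M y)⁻¹) N := fun k l => DirD.of_diff (hd k l)
  have hu : ∀ y, IsUnit (M y).det := fun y => (h0 y).isUnit
  have h1 : M' * (M x)⁻¹ + M x * N = 0 := by
    ext k l
    rw [← ((hM.mul hN) k l).fderiv_eq]
    simp [Matrix.mul_nonsing_inv _ (hu _)]
  have h2 : N = -((M x)⁻¹ * M' * (M x)⁻¹) := by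
    have := congrArg (fun A => (M x)⁻¹ * A) h1
    simp only [Matrix.mul_add, ← Matrix.mul_assoc, Matrix.nonsing_inv_mul _ (hu _),
      Matrix.one_mul, Matrix.mul_zero] at this
    exact eq_neg_of_add_eq_zero_right this
  rw [← h2]
  exact hN

theorem quadForm_add (A B : Matrix (Fin n) (Fin n) ℝ) (q : Fin n → ℝ) :
    quadForm (A + B) q = quadForm A q + quadForm B q := by
  simp [quadForm, mul_add, add_mul, Finset.sum_add_distrib]

theorem quadForm_neg (A : Matrix (Fin n) (Fin n) ℝ) (q : Fin n → ℝ) :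
    quadForm (-A) q = - quadForm A q := by
  simp [quadForm]

theorem quadForm_sum {ι : Type*} (s : Finset ι) (A : ι → Matrix (Fin n) (Fin n) ℝ)
    (q : Fin n → ℝ) : quadForm (∑ i ∈ s, A i) q = ∑ i ∈ s, quadForm (A i) q := by
  classical
  induction s using Finset.induction_on with
  | empty => simp [quadForm]
  | insert a s ha ih => rw [Finset.sum_insert ha, Finset.sum_insert ha, quadForm_add, ih]

theorem MatD.gauss {M : E → Matrix (Fin n) (Fin n) ℝ} {M' : Matrix (Fin n) (Fin n) ℝ}
    (hM : MatD v x M M') (h0 : ∀ y, 0 < (M y).det) (q : Fin n → ℝ) :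
    DirD v x (fun y => gaussPdf (M y) q)
      ((1 / 2) * (quadForm ((M x)⁻¹ * M' * (M x)⁻¹) q - ((M x)⁻¹ * M').trace)
        * gaussPdf (M x) q) := by
  have hi := hM.inv (fun y => (h0 y).ne')
  have he := ((DirD.const (v := v) (x := x) (-(1 / 2))).mul (hi.quad q)).comp
    (Real.hasDerivAt_exp _)
  have hp : ∀ y, 0 < (2 * Real.pi) ^ n * (M y).det := fun y => mul_pos (by positivity) (h0 y)
  have hs := ((DirD.const (v := v) (x := x) ((2 * Real.pi) ^ n)).mul hM.det).comp
    ((Real.hasDerivAt_sqrt (hp x).ne').inv (Real.sqrt_pos.2 (hp x)).ne')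
  have hh := he.mul hs
  have hadj : ((M x).adjugate * M').trace = (M x).det * ((M x)⁻¹ * M').trace := by
    rw [Matrix.inv_def, Ring.inverse_eq_inv', Matrix.smul_mul, Matrix.trace_smul, smul_eq_mul,
      mul_inv_cancel_left₀ (h0 x).ne']
  rw [hadj, quadForm_neg] at hh
  have hfun : (fun y => gaussPdf (M y) q) = fun y => rexp (-(1 / 2) * quadForm (M y)⁻¹ q) *
      (fun x => √x)⁻¹ ((2 * π) ^ n * (M y).det) := by
    funext y
    simp only [gaussPdf, div_eq_mul_inv, Pi.inv_apply]
  rw [hfun]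
  convert hh using 1
  have hs2 := Real.sq_sqrt (hp x).le
  have hs3 := (Real.sqrt_pos.2 (hp x)).ne'
  simp only [gaussPdf, Pi.inv_apply]
  set S := √((2 * Real.pi) ^ n * (M x).det)
  have : (2 * Real.pi) ^ n * ((M x).det * ((M x)⁻¹ * M').trace) = S ^ 2 * ((M x)⁻¹ * M').trace := by
    rw [hs2]; ring
  rw [zero_mul, zero_add, zero_mul, zero_add, this]
  field_simp
  ring

end helpers

theorem second_partial {n d : ℕ} (C : (Fin d → ℝ) → Matrix (Fin n) (Fin n) ℝ)
    (hpos : ∀ x, (C x).PosDef) (x₀ : Fin d → ℝ)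
    (hC : ∀ k l, ContDiffAt ℝ 2 (fun x => C x k l) x₀) (q : Fin n → ℝ) (i : Fin d) :
    fderiv ℝ (fun x => fderiv ℝ (fun y => gaussPdf (C y) q) x (Pi.single i 1)) x₀
        (Pi.single i 1)
      = ((1 / 2) * (quadForm ((C x₀)⁻¹ * matPartial2 C x₀ i * (C x₀)⁻¹) q
            - ((C x₀)⁻¹ * matPartial2 C x₀ i).trace)
        - (quadForm
              ((C x₀)⁻¹ * matPartial C x₀ i * (C x₀)⁻¹ * matPartial C x₀ i * (C x₀)⁻¹) q
            - (1 / 2) * (((C x₀)⁻¹ * matPartial C x₀ i) * ((C x₀)⁻¹ * matPartial C x₀ i)).trace)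
        + (1 / 4) * (quadForm ((C x₀)⁻¹ * matPartial C x₀ i * (C x₀)⁻¹) q
            - ((C x₀)⁻¹ * matPartial C x₀ i).trace) ^ 2)
        * gaussPdf (C x₀) q := by
  have h0 : ∀ y, 0 < (C y).det := fun y => (hpos y).det_pos
  have hev : ∀ᶠ x in nhds x₀, ∀ k l, DifferentiableAt ℝ (fun x => C x k l) x := by
    rw [Filter.eventually_all]; intro k
    rw [Filter.eventually_all]; intro l
    filter_upwards [(hC k l).eventually (by simp)] with x hx
    exact hx.differentiableAt (by simp)
  have hM : ∀ x, (∀ k l, DifferentiableAt ℝ (fun x => C x k l) x) →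
      MatD (Pi.single i 1) x C (matPartial C x i) := fun x hx k l => DirD.of_diff (hx k l)
  have heq : (fun x => fderiv ℝ (fun y => gaussPdf (C y) q) x (Pi.single i 1)) =ᶠ[nhds x₀]
      fun x => (1 / 2) * (quadForm ((C x)⁻¹ * matPartial C x i * (C x)⁻¹) q
        - ((C x)⁻¹ * matPartial C x i).trace) * gaussPdf (C x) q := by
    filter_upwards [hev] with x hx
    exact ((hM x hx).gauss h0 q).fderiv_eq
  rw [heq.fderiv_eq]
  have hD : MatD (Pi.single i 1) x₀ (fun x => matPartial C x i) (matPartial2 C x₀ i) := by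
    intro k l
    refine DirD.of_diff (f := fun x => fderiv ℝ (fun y => C y k l) x (Pi.single i 1)) ?_
    have : DifferentiableAt ℝ (fderiv ℝ (fun y => C y k l)) x₀ :=
      ((hC k l).fderiv_right (m := 1) (by norm_num)).differentiableAt (by simp)
    exact this.clm_apply (differentiableAt_const _)
  have hM0 := hM x₀ hev.self_of_nhds
  have hI := hM0.inv (fun y => (h0 y).ne')
  have hID := hI.mul hD
  have hG := hM0.gauss h0 q
  have := ((DirD.const (1 / 2)).mul (((hID.mul hI).quad q).sub hID.trace)).mul hG
  rw [this.fderiv_eq]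
  simp only [Matrix.add_mul, Matrix.neg_mul, Matrix.mul_neg, quadForm_add, quadForm_neg,
    Matrix.trace_add, Matrix.trace_neg, ← Matrix.mul_assoc]
  ring

/-- The Laplacian in `x` of `x ↦ Φ(C(x), q)` for a twice differentiable family of symmetric
positive definite covariance matrices, expressed through the first and second partial
derivatives `Dᵢ = ∂C/∂xᵢ(x₀)` and `Eᵢ = ∂²C/∂xᵢ²(x₀)`. -/
theorem laplacian_x_gaussPdf_comp {n d : ℕ} (C : (Fin d → ℝ) → Matrix (Fin n) (Fin n) ℝ)
    (hpos : ∀ x, (C x).PosDef) (x₀ : Fin d → ℝ)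
    (hC : ∀ k l, ContDiffAt ℝ 2 (fun x => C x k l) x₀) (q : Fin n → ℝ) :
    (∑ i, fderiv ℝ (fun x => fderiv ℝ (fun y => gaussPdf (C y) q) x (Pi.single i 1)) x₀
        (Pi.single i 1))
      = ((1 / 2) * (quadForm ((C x₀)⁻¹ * (∑ i, matPartial2 C x₀ i) * (C x₀)⁻¹) q
            - ((C x₀)⁻¹ * ∑ i, matPartial2 C x₀ i).trace)
        - (∑ i, (quadForm
              ((C x₀)⁻¹ * matPartial C x₀ i * (C x₀)⁻¹ * matPartial C x₀ i * (C x₀)⁻¹) q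
            - (1 / 2) * (((C x₀)⁻¹ * matPartial C x₀ i) * ((C x₀)⁻¹ * matPartial C x₀ i)).trace))
        + (1 / 4) * ∑ i, (quadForm ((C x₀)⁻¹ * matPartial C x₀ i * (C x₀)⁻¹) q
            - ((C x₀)⁻¹ * matPartial C x₀ i).trace) ^ 2)
        * gaussPdf (C x₀) q := by
  rw [Finset.sum_congr rfl fun i _ => second_partial C hpos x₀ hC q i]
  simp only [Finset.mul_sum, Finset.sum_mul, quadForm_sum, Matrix.trace_sum]
  rw [← Finset.sum_mul]
  congr 1
  simp only [Finset.sum_add_distrib, Finset.sum_sub_distrib, Finset.mul_sum, mul_sub]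
end
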